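/- arXiv:2302.08752 — 2 statements merged into one kernel-verified Lean document; each statement's English description precedes it below -/
import Mathlib

section
/- Let 1/2 < σ ≤ 1 and for k ≥ 1 set B_k := ∑_{j=k}^∞ 1/j². Then for all natural numbers m < n, the strict inequality (m^{-σ} − n^{-σ})/(B_m − B_n) < (m^{-σ} − (n+1)^{-σ})/(B_m − B_{n+1}) holds; that is, for each fixed m the sequence n ↦ (m^{-σ} − n^{-σ})/(B_m − B_n), n > m, is strictly increasing. -/
open scoped BigOperators

/-- The tail sum `B_k = ∑_{j=k}^∞ 1/j²`. -/
noncomputable def Btail (k : ℕ) : ℝ := ∑' j : ℕ, (1 : ℝ) / ((j + k : ℕ) : ℝ) ^ 2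

theorem Btail_eq_add_Btail_succ (k : ℕ) : Btail k = 1 / (k : ℝ) ^ 2 + Btail (k + 1) := by
  have hs : Summable fun j : ℕ => (1 : ℝ) / ((j + k : ℕ) : ℝ) ^ 2 :=
    (summable_nat_add_iff (f := fun j : ℕ => (1 : ℝ) / (j : ℝ) ^ 2) k).2
      (Real.summable_one_div_nat_pow.2 one_lt_two)
  unfold Btail
  rw [hs.tsum_eq_zero_add]
  simp only [zero_add, add_assoc, add_comm 1 k]

theorem sq_mul_rpow_neg_sub_lt_succ {σ x : ℝ} (h0 : 0 < σ) (h1 : σ ≤ 1) (hx : 0 < x) :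
    x ^ 2 * (x ^ (-σ) - (x + 1) ^ (-σ)) <
      (x + 1) ^ 2 * ((x + 1) ^ (-σ) - (x + 1 + 1) ^ (-σ)) := by
  have hu : 0 < x + 1 := by linarith
  have hv : 0 < x + 1 + 1 := by linarith
  have hP : 0 < (x + 1) ^ (-σ) := Real.rpow_pos_of_pos hu _
  have hlow : x ^ (-σ) ≤ (x + 1) ^ (-σ) * (1 + σ * x⁻¹) := by
    have hb := rpow_one_add_le_one_add_mul_self (s := x⁻¹) (p := σ)
      (by linarith [inv_pos.2 hx]) h0.le h1
    have he : x ^ (-σ) = (x + 1) ^ (-σ) * (1 + x⁻¹) ^ σ := by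
      rw [show 1 + x⁻¹ = (x + 1) / x by field_simp, Real.div_rpow hu.le hx.le,
        Real.rpow_neg hu.le, Real.rpow_neg hx.le]
      have := (Real.rpow_pos_of_pos hu σ).ne'
      field_simp
    rw [he]
    gcongr
  have hhigh : (x + 1 + 1) ^ (-σ) ≤ (x + 1) ^ (-σ) * (1 - σ * (x + 1 + 1)⁻¹) := by
    have hb := rpow_one_add_le_one_add_mul_self (s := -(x + 1 + 1)⁻¹) (p := σ)
      (neg_le_neg (inv_le_one_of_one_le₀ (by linarith))) h0.le h1
    have he : (x + 1 + 1) ^ (-σ) = (x + 1) ^ (-σ) * (1 + -(x + 1 + 1)⁻¹) ^ σ := by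
      rw [show 1 + -(x + 1 + 1)⁻¹ = (x + 1) / (x + 1 + 1) by field_simp; ring,
        Real.div_rpow hu.le hv.le, Real.rpow_neg hu.le, Real.rpow_neg hv.le]
      have := (Real.rpow_pos_of_pos hu σ).ne'
      field_simp
    rw [he]
    refine mul_le_mul_of_nonneg_left ?_ hP.le
    linarith
  calc x ^ 2 * (x ^ (-σ) - (x + 1) ^ (-σ))
      ≤ x ^ 2 * ((x + 1) ^ (-σ) * (1 + σ * x⁻¹) - (x + 1) ^ (-σ)) := by gcongr
    _ = (x + 1) ^ (-σ) * σ * x := by field_simp; ring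
    _ < (x + 1) ^ (-σ) * σ * ((x + 1) ^ 2 / (x + 1 + 1)) := by
        refine mul_lt_mul_of_pos_left ?_ (mul_pos hP h0)
        rw [lt_div_iff₀ hv]
        nlinarith
    _ = (x + 1) ^ 2 * ((x + 1) ^ (-σ) - (x + 1) ^ (-σ) * (1 - σ * (x + 1 + 1)⁻¹)) := by
        field_simp; ring
    _ ≤ (x + 1) ^ 2 * ((x + 1) ^ (-σ) - (x + 1 + 1) ^ (-σ)) := by gcongr

theorem Btail_succ_lt {k : ℕ} (hk : 1 ≤ k) : Btail (k + 1) < Btail k := by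
  have hk0 : (0 : ℝ) < k := by exact_mod_cast hk
  have : 0 < 1 / (k : ℝ) ^ 2 := by positivity
  linarith [Btail_eq_add_Btail_succ k]

theorem Btail_lt {m n : ℕ} (hm : 1 ≤ m) (hmn : m < n) : Btail n < Btail m := by
  induction n, hmn using Nat.le_induction with
  | base => exact Btail_succ_lt hm
  | succ n hn ih => exact (Btail_succ_lt (by omega)).trans ih

theorem rpow_neg_sub_lt_mul_Btail_sub {σ : ℝ} (h0 : 0 < σ) (h1 : σ ≤ 1) {m n : ℕ}
    (hm : 1 ≤ m) (hmn : m < n) :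
    (m : ℝ) ^ (-σ) - (n : ℝ) ^ (-σ) <
      (n : ℝ) ^ 2 * ((n : ℝ) ^ (-σ) - ((n : ℝ) + 1) ^ (-σ)) * (Btail m - Btail n) := by
  have step : ∀ k : ℕ, m ≤ k →
      (m : ℝ) ^ (-σ) - (k : ℝ) ^ (-σ) ≤
        (k : ℝ) ^ 2 * ((k : ℝ) ^ (-σ) - ((k : ℝ) + 1) ^ (-σ)) * (Btail m - Btail k) →
      (m : ℝ) ^ (-σ) - ((k + 1 : ℕ) : ℝ) ^ (-σ) <
        ((k + 1 : ℕ) : ℝ) ^ 2 * (((k + 1 : ℕ) : ℝ) ^ (-σ) - (((k + 1 : ℕ) : ℝ) + 1) ^ (-σ)) *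
          (Btail m - Btail (k + 1)) := by
    intro k hk ih
    have hk0 : (0 : ℝ) < k := by exact_mod_cast hm.trans hk
    have hB : 0 < Btail m - Btail (k + 1) := sub_pos.2 (Btail_lt hm (by omega))
    push_cast
    refine lt_of_le_of_lt ?_
      (mul_lt_mul_of_pos_right (sq_mul_rpow_neg_sub_lt_succ h0 h1 hk0) hB)
    have hsplit : Btail m - Btail (k + 1) = (Btail m - Btail k) + 1 / (k : ℝ) ^ 2 := by
      linarith [Btail_eq_add_Btail_succ k]
    have hlast : (k : ℝ) ^ 2 * ((k : ℝ) ^ (-σ) - ((k : ℝ) + 1) ^ (-σ)) * (1 / (k : ℝ) ^ 2) =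
        (k : ℝ) ^ (-σ) - ((k : ℝ) + 1) ^ (-σ) := by
      field_simp
    rw [hsplit, mul_add, hlast]
    linarith
  induction n, hmn using Nat.le_induction with
  | base => exact step m le_rfl (by simp)
  | succ n hn ih => exact step n (by omega) ih.le

theorem statement7 (σ : ℝ) (h1 : 1 / 2 < σ) (h2 : σ ≤ 1)
    (m n : ℕ) (hm : 1 ≤ m) (hmn : m < n) :
    ((m : ℝ) ^ (-σ) - (n : ℝ) ^ (-σ)) / (Btail m - Btail n) <
    ((m : ℝ) ^ (-σ) - ((n : ℝ) + 1) ^ (-σ)) / (Btail m - Btail (n + 1)) := by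
  have hn0 : (0 : ℝ) < n := by exact_mod_cast hm.trans hmn.le
  have hB : 0 < Btail m - Btail n := sub_pos.2 (Btail_lt hm hmn)
  have hB' : 0 < Btail m - Btail (n + 1) := sub_pos.2 (Btail_lt hm (by omega))
  have key := rpow_neg_sub_lt_mul_Btail_sub (by linarith) h2 hm hmn
  have hsplit : Btail m - Btail (n + 1) = (Btail m - Btail n) + 1 / (n : ℝ) ^ 2 := by
    linarith [Btail_eq_add_Btail_succ n]
  rw [div_lt_div_iff₀ hB hB', hsplit]
  have hdiv := mul_lt_mul_of_pos_right key (by positivity : 0 < 1 / (n : ℝ) ^ 2)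
  have hlast : (n : ℝ) ^ 2 * ((n : ℝ) ^ (-σ) - ((n : ℝ) + 1) ^ (-σ)) * (Btail m - Btail n) *
      (1 / (n : ℝ) ^ 2) = ((n : ℝ) ^ (-σ) - ((n : ℝ) + 1) ^ (-σ)) * (Btail m - Btail n) := by
    field_simp
  rw [hlast] at hdiv
  linarith
end

section
/- Let 1 < q < ∞ and φ(x) := x log x for x ≥ 1. There exists x_q ≥ 1 such that the following holds: for every integer m ≥ 2 and every integer r_m > m satisfying m·p_r/(m+1) ≤ r log r ≤ m·p_r/(m−1) for all r ≥ r_m (where p_r denotes the r-th prime), if r_m ≥ x_q, then for every real γ ≥ p_{r_m} and every real α with 0 < α ≤ 1/q, max{ (mγ/(m+1))^α − φ(r_m)^α, 0 } ≤ ∑_{r ≥ r_m, p_r ≤ γ} (φ^α)'(r) ≤ (mγ/(m−1))^α − φ(r_m − 1)^α, where (φ^α)'(x) = α (x log x)^{α−1}(log x + 1). -/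
open scoped BigOperators Classical

/-- The function `φ(x) = x log x`. -/
noncomputable def phi (x : ℝ) : ℝ := x * Real.log x

/-- The derivative of `x ↦ φ(x)^α`, namely `(φ^α)'(x) = α (x log x)^{α-1}(log x + 1)`. -/
noncomputable def dphi (α x : ℝ) : ℝ := α * (x * Real.log x) ^ (α - 1) * (Real.log x + 1)

/-- The `r`-th prime number (the primes written in increasing order, `nthPrime 1 = 2`). -/
noncomputable def nthPrime (r : ℕ) : ℕ := Nat.nth Nat.Prime (r - 1)

lemma nthPrime_le_iff {r : ℕ} (hr : 1 ≤ r) {γ : ℝ} (hγ : 0 ≤ γ) :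
    (nthPrime r : ℝ) ≤ γ ↔ r ≤ Nat.count Nat.Prime (⌊γ⌋₊ + 1) := by
  rw [← Nat.le_floor_iff hγ, nthPrime, ← Nat.lt_succ_iff, Nat.succ_eq_add_one,
    ← not_le, ← Nat.count_le_iff_le_nth Nat.infinite_setOfPred_prime]
  change ¬Nat.count Nat.Prime (⌊γ⌋₊ + 1) ≤ r - 1 ↔ _
  omega

lemma hasDerivAt_phi_rpow {α x : ℝ} (hx : 1 < x) :
    HasDerivAt (fun y => phi y ^ α) (dphi α x) x := by
  have hlog : 0 < Real.log x := Real.log_pos hx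
  have hx0 : x ≠ 0 := by linarith
  have h : HasDerivAt phi (Real.log x + 1) x := Real.hasDerivAt_mul_log hx0
  have hφ : phi x ≠ 0 := mul_ne_zero hx0 hlog.ne'
  convert h.rpow_const (p := α) (Or.inl hφ) using 1
  simp only [dphi, phi]
  ring

lemma dphi_nonneg {α x : ℝ} (hα : 0 ≤ α) (hx : 1 ≤ x) : 0 ≤ dphi α x := by
  have := Real.log_nonneg hx
  unfold dphi
  positivity

lemma dphi_antitoneOn {q α : ℝ} (hq : 1 < q) (hα : 0 < α) (hαq : α ≤ 1 / q) :
    AntitoneOn (dphi α) (Set.Ici (Real.exp (1 / (q - 1)))) := by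
  have hq1 : 0 < q - 1 := by linarith
  have hαq' : α * q ≤ 1 := (le_div_iff₀ (by linarith)).1 hαq
  have hα1 : α < 1 := by nlinarith
  have hexp : 1 < Real.exp (1 / (q - 1)) := Real.one_lt_exp_iff.2 (by positivity)
  have ha : 0 < (1 - α) / α := div_pos (by linarith) hα
  have haq : ((1 - α) / α)⁻¹ ≤ 1 / (q - 1) :=
    one_div (q - 1) ▸ inv_anti₀ hq1 (by rw [le_div_iff₀ hα]; linarith)
  have decomp : ∀ x : ℝ, 1 < x → dphi α x =
      α * ((Real.log x / x ^ ((1 - α) / α)) ^ α + (x * Real.log x) ^ (α - 1)) := by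
    intro x hx
    have hx0 : 0 < x := by linarith
    have hlog : 0 < Real.log x := Real.log_pos hx
    have h : (Real.log x / x ^ ((1 - α) / α)) ^ α = (x * Real.log x) ^ (α - 1) * Real.log x := by
      rw [Real.div_rpow hlog.le (by positivity), ← Real.rpow_mul hx0.le,
        div_mul_cancel₀ _ hα.ne', Real.mul_rpow hx0.le hlog.le, mul_assoc,
        ← Real.rpow_add_one hlog.ne', sub_add_cancel, div_eq_mul_inv, ← Real.rpow_neg hx0.le,
        neg_sub, mul_comm]
    rw [h, dphi]
    ring
  intro x hx y hy hxy
  have hx' : Real.exp (1 / (q - 1)) ≤ x := hx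
  have hx1 : 1 < x := lt_of_lt_of_le hexp hx
  have hy1 : 1 < y := lt_of_lt_of_le hexp hy
  have hlogx : 0 < Real.log x := Real.log_pos hx1
  have hlogy : 0 < Real.log y := Real.log_pos hy1
  have hthr : Real.exp (((1 - α) / α)⁻¹) ≤ x := (Real.exp_le_exp.2 haq).trans hx'
  have h1 : Real.log y / y ^ ((1 - α) / α) ≤ Real.log x / x ^ ((1 - α) / α) :=
    Real.log_div_self_rpow_antitoneOn ha hthr (hthr.trans hxy) hxy
  have hxy_log : x * Real.log x ≤ y * Real.log y :=
    mul_le_mul hxy (Real.log_le_log (by linarith) hxy) hlogx.le (by linarith)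
  rw [decomp x hx1, decomp y hy1]
  refine mul_le_mul_of_nonneg_left (add_le_add ?_ ?_) hα.le
  · exact Real.rpow_le_rpow (by positivity) h1 hα.le
  · exact Real.rpow_le_rpow_of_nonpos (by positivity) hxy_log (by linarith)

/-- The mean value theorem for `φ ^ α` on `[x, x + 1]`, in the range where its derivative is
decreasing. -/
lemma phi_rpow_sub_mem_Icc {q α x : ℝ} (hq : 1 < q) (hα : 0 < α) (hαq : α ≤ 1 / q)
    (hx : Real.exp (1 / (q - 1)) ≤ x) :
    phi (x + 1) ^ α - phi x ^ α ∈ Set.Icc (dphi α (x + 1)) (dphi α x) := by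
  have hq1 : 0 < q - 1 := by linarith
  have hexp : 1 < Real.exp (1 / (q - 1)) := Real.one_lt_exp_iff.2 (by positivity)
  have hd : ∀ y ∈ Set.Icc x (x + 1), HasDerivAt (fun y => phi y ^ α) (dphi α y) y :=
    fun y hy => hasDerivAt_phi_rpow (by linarith [hy.1])
  obtain ⟨c, hc, hceq⟩ := exists_hasDerivAt_eq_slope (fun y => phi y ^ α) (dphi α)
    (lt_add_one x) (fun y hy => (hd y hy).continuousAt.continuousWithinAt)
    (fun y hy => hd y (Set.Ioo_subset_Icc_self hy))
  rw [add_sub_cancel_left, div_one] at hceq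
  rw [← hceq]
  have hanti := dphi_antitoneOn hq hα hαq
  have hcx : Real.exp (1 / (q - 1)) ≤ c := hx.trans hc.1.le
  exact ⟨hanti hcx (hcx.trans hc.2.le) hc.2.le, hanti hx hcx hc.1.le⟩

lemma le_sum_dphi {q α : ℝ} (hq : 1 < q) (hα : 0 < α) (hαq : α ≤ 1 / q) {a b : ℕ}
    (hab : a ≤ b) (ha : Real.exp (1 / (q - 1)) ≤ a) :
    phi b ^ α - phi a ^ α ≤ ∑ r ∈ Finset.Ico a b, dphi α r := by
  rw [← Finset.sum_Ico_sub (fun r : ℕ => phi r ^ α) hab]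
  refine Finset.sum_le_sum fun r hr => ?_
  have har : (a : ℝ) ≤ r := by exact_mod_cast (Finset.mem_Ico.1 hr).1
  rw [Nat.cast_add_one]
  exact (phi_rpow_sub_mem_Icc hq hα hαq (ha.trans har)).2

lemma sum_dphi_le {q α : ℝ} (hq : 1 < q) (hα : 0 < α) (hαq : α ≤ 1 / q) {a b : ℕ}
    (hab : a ≤ b) (ha : Real.exp (1 / (q - 1)) ≤ (a : ℝ) - 1) :
    ∑ r ∈ Finset.Ico a b, dphi α r ≤ phi ((b : ℝ) - 1) ^ α - phi ((a : ℝ) - 1) ^ α := by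
  rw [← Finset.sum_Ico_sub (fun r : ℕ => phi ((r : ℝ) - 1) ^ α) hab]
  refine Finset.sum_le_sum fun r hr => ?_
  have har : (a : ℝ) ≤ r := by exact_mod_cast (Finset.mem_Ico.1 hr).1
  have h := (phi_rpow_sub_mem_Icc (x := (r : ℝ) - 1) hq hα hαq (by linarith)).1
  simpa using h

theorem statement16 (q : ℝ) (hq : 1 < q) :
    ∃ xq : ℝ, 1 ≤ xq ∧
      ∀ m : ℕ, 2 ≤ m →
      ∀ rm : ℕ, m < rm →
        (∀ r : ℕ, rm ≤ r →
          (m : ℝ) * (nthPrime r : ℝ) / ((m : ℝ) + 1) ≤ (r : ℝ) * Real.log r ∧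
          (r : ℝ) * Real.log r ≤ (m : ℝ) * (nthPrime r : ℝ) / ((m : ℝ) - 1)) →
        xq ≤ (rm : ℝ) →
      ∀ γ : ℝ, (nthPrime rm : ℝ) ≤ γ →
      ∀ α : ℝ, 0 < α → α ≤ 1 / q →
        max (((m : ℝ) * γ / ((m : ℝ) + 1)) ^ α - phi rm ^ α) 0 ≤
          (∑' r : ℕ, if rm ≤ r ∧ (nthPrime r : ℝ) ≤ γ then dphi α r else 0) ∧
        (∑' r : ℕ, if rm ≤ r ∧ (nthPrime r : ℝ) ≤ γ then dphi α r else 0) ≤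
          ((m : ℝ) * γ / ((m : ℝ) - 1)) ^ α - phi ((rm : ℝ) - 1) ^ α := by
  have hq1 : 0 < q - 1 := by linarith
  have hexp : 1 < Real.exp (1 / (q - 1)) := Real.one_lt_exp_iff.2 (by positivity)
  refine ⟨Real.exp (1 / (q - 1)) + 1, by linarith, ?_⟩
  intro m hm rm hmrm hp hrm γ hγ α hα hαq
  have hm' : (2 : ℝ) ≤ m := by exact_mod_cast hm
  have hγ0 : 0 ≤ γ := (Nat.cast_nonneg _).trans hγ
  set R := Nat.count Nat.Prime (⌊γ⌋₊ + 1)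
  have hle : ∀ r, rm ≤ r → ((nthPrime r : ℝ) ≤ γ ↔ r ≤ R) :=
    fun r hr => nthPrime_le_iff (by omega) hγ0
  have hrmR : rm ≤ R := (hle rm le_rfl).1 hγ
  have hsum : (∑' r : ℕ, if rm ≤ r ∧ (nthPrime r : ℝ) ≤ γ then dphi α r else 0) =
      ∑ r ∈ Finset.Ico rm (R + 1), dphi α r := by
    have hmem : ∀ r, (rm ≤ r ∧ (nthPrime r : ℝ) ≤ γ) ↔ r ∈ Finset.Ico rm (R + 1) := by
      intro r
      rw [Finset.mem_Ico, Nat.lt_succ_iff]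
      exact and_congr_right (hle r)
    rw [tsum_eq_sum (s := Finset.Ico rm (R + 1))
      (fun r hr => if_neg (mt (hmem r).1 hr))]
    exact Finset.sum_congr rfl fun r hr => if_pos ((hmem r).2 hr)
  rw [hsum]
  have hrmR' : (rm : ℝ) ≤ R := by exact_mod_cast hrmR
  refine ⟨max_le ?_ (Finset.sum_nonneg fun r hr => ?_), ?_⟩
  · refine le_trans (sub_le_sub_right ?_ _)
      (le_sum_dphi hq hα hαq (a := rm) (b := R + 1) (by omega) (by linarith))
    have hlt : γ ≤ nthPrime (R + 1) := by
      have := (hle (R + 1) (by omega)).not.2 (by omega)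
      linarith
    refine Real.rpow_le_rpow (by positivity) ?_ hα.le
    refine le_trans ?_ (hp (R + 1) (by omega)).1
    gcongr
  · have : (rm : ℝ) ≤ r := by exact_mod_cast (Finset.mem_Ico.1 hr).1
    exact dphi_nonneg hα.le (by linarith)
  · refine (sum_dphi_le hq hα hαq (a := rm) (b := R + 1) (by omega) (by linarith)).trans
      (sub_le_sub_right ?_ _)
    rw [Nat.cast_add_one, add_sub_cancel_right]
    refine Real.rpow_le_rpow
      (mul_nonneg (by linarith) (Real.log_nonneg (by linarith))) ?_ hα.le
    refine (hp R hrmR).2.trans ?_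
    have : (0 : ℝ) < (m : ℝ) - 1 := by linarith
    gcongr
    exact (hle R hrmR).2 le_rfl
end
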